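/- arXiv:2304.13196 — 3 statements merged into one kernel-verified Lean document; each statement's English description precedes it below -/
import Mathlib

section
/- Let g ≥ 2, let R be a finite-index normal subgroup of the surface group π₁Σ_g, let G = π₁Σ_g/R be the (finite) quotient group, and let k be a field of characteristic 0. Equip H₁(R;k) := Abelianization(R) ⊗_ℤ k with the k[G]-module structure induced by the conjugation action of π₁Σ_g on R. Then H₁(R;k) is isomorphic as a k[G]-module to k² ⊕ (k[G])^{2g−2}, where k² carries the trivial G-action and k[G] is the regular representation. -/
/-- The surface relator `[x₁,y₁]⋯[x_g,y_g]`, with `xᵢ = (i, false)`, `yᵢ = (i, true)`. -/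
def surfaceRelator (g : ℕ) : FreeGroup (Fin g × Bool) :=
  (List.ofFn fun i : Fin g =>
    FreeGroup.of (i, false) * FreeGroup.of (i, true) *
      (FreeGroup.of (i, false))⁻¹ * (FreeGroup.of (i, true))⁻¹).prod

/-- The genus-`g` surface group. -/
def SurfaceGroup (g : ℕ) : Type :=
  PresentedGroup {surfaceRelator g}

instance (g : ℕ) : Group (SurfaceGroup g) :=
  inferInstanceAs (Group (PresentedGroup _))

/-- The standard generators of the surface group. -/
def surfaceGen (g : ℕ) (i : Fin g × Bool) : SurfaceGroup g :=
  PresentedGroup.of i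

lemma lift_surfaceRelator {G : Type} [CommGroup G] (g : ℕ) (f : Fin g × Bool → G) :
    FreeGroup.lift f (surfaceRelator g) = 1 := by
  rw [surfaceRelator, map_list_prod]
  refine List.prod_eq_one ?_
  intro x hx
  simp only [List.map_ofFn, List.mem_ofFn, Function.comp] at hx
  obtain ⟨i, rfl⟩ := hx
  simp [mul_comm, mul_assoc, mul_left_comm]

/-- The mod-`d` abelianization of the free group on `m` generators. -/
def freeModAb (m d : ℕ) : FreeGroup (Fin m) →* Multiplicative (Fin m → ZMod d) :=
  FreeGroup.lift fun i => Multiplicative.ofAdd (Pi.single i (1 : ZMod d))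

/-- The mod-`d` abelianization of the genus-`g` surface group. -/
def surfaceModAb (g d : ℕ) : SurfaceGroup g →* Multiplicative (Fin g × Bool → ZMod d) :=
  PresentedGroup.toGroup
    (f := fun i => Multiplicative.ofAdd (Pi.single i (1 : ZMod d)))
    (by intro r hr
        rw [Set.mem_singleton_iff] at hr
        subst hr
        exact lift_surfaceRelator _ _)


open scoped TensorProduct

noncomputable section

variable {π : Type} [Group π]

/-- Conjugation action of π on the abelianization of a normal subgroup R. -/
def conjAbAut (R : Subgroup π) [R.Normal] : π →* MulAut (Abelianization ↥R) where
  toFun p := MulEquiv.abelianizationCongr (MulAut.conjNormal p)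
  map_one' := by simp [MulAut.one_def]
  map_mul' := fun p q => by simp [MulAut.mul_def]

/-- The conjugation action descends to the quotient π ⧸ R, since inner automorphisms by
elements of R act trivially on the abelianization of R. -/
def conjQuotAut (R : Subgroup π) [R.Normal] : π ⧸ R →* MulAut (Abelianization ↥R) :=
  QuotientGroup.lift R (conjAbAut R) (by
    intro r hr
    ext x
    refine QuotientGroup.induction_on x ?_
    intro y
    show (MulEquiv.abelianizationCongr (MulAut.conjNormal r)) (Abelianization.of y)
        = Abelianization.of y
    rw [abelianizationCongr_of]
    have : (MulAut.conjNormal r) y = (⟨r, hr⟩ : ↥R) * y * (⟨r, hr⟩ : ↥R)⁻¹ := by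
      ext; simp
    rw [this, map_mul, map_mul, map_inv, mul_comm, inv_mul_cancel_left])

/-- A multiplicative automorphism of a commutative group as a ℤ-linear endomorphism of the
additivization. -/
def mulAutToEnd {A : Type} [CommGroup A] (e : MulAut A) :
    Additive A →ₗ[ℤ] Additive A :=
  AddMonoidHom.toIntLinearMap
    { toFun := fun x => Additive.ofMul (e x.toMul)
      map_zero' := by simp
      map_add' := fun a b => by simp }

lemma mulAutToEnd_one {A : Type} [CommGroup A] :
    mulAutToEnd (1 : MulAut A) = LinearMap.id := by
  ext x; rfl

lemma mulAutToEnd_mul {A : Type} [CommGroup A] (e f : MulAut A) :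
    mulAutToEnd (e * f) = (mulAutToEnd e).comp (mulAutToEnd f) := by
  ext x; rfl

/-- The k[G]-module structure (as a representation of G = π ⧸ R over k) on
H₁(R;k) = k ⊗ Abelianization R, induced by the conjugation action of π on R. -/
def conjRep (R : Subgroup π) [R.Normal] (k : Type) [CommRing k] :
    Representation k (π ⧸ R) (k ⊗[ℤ] Additive (Abelianization ↥R)) where
  toFun g := LinearMap.baseChange k (mulAutToEnd (conjQuotAut R g))
  map_one' := by
    show LinearMap.baseChange k (mulAutToEnd ((conjQuotAut R) 1)) = 1
    rw [map_one, mulAutToEnd_one]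
    exact LinearMap.baseChange_id
  map_mul' := fun g h => by
    show LinearMap.baseChange k (mulAutToEnd ((conjQuotAut R) (g * h)))
        = LinearMap.baseChange k (mulAutToEnd ((conjQuotAut R) g))
          * LinearMap.baseChange k (mulAutToEnd ((conjQuotAut R) h))
    rw [map_mul, mulAutToEnd_mul, LinearMap.baseChange_comp]
    rfl

section Cancel
variable {Λ : Type} [Ring Λ]

lemma quot_equiv_of_simple {M : Type} [AddCommGroup M] [Module Λ M] [IsSemisimpleModule Λ M]
    (P Q : Submodule Λ M) [IsSimpleModule Λ P] (e : P ≃ₗ[Λ] Q) :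
    Nonempty ((M ⧸ P) ≃ₗ[Λ] (M ⧸ Q)) := by
  by_cases h : P = Q
  · subst h; exact ⟨LinearEquiv.refl _ _⟩
  have hQ : IsSimpleModule Λ Q := IsSimpleModule.congr e.symm
  have hP' : IsAtom P := isSimpleModule_iff_isAtom.1 inferInstance
  have hQ' : IsAtom Q := isSimpleModule_iff_isAtom.1 inferInstance
  have hd : Disjoint P Q := hP'.disjoint_of_ne hQ' h
  obtain ⟨C, hC⟩ := exists_isCompl (P ⊔ Q)
  have key : ∀ P Q : Submodule Λ M, Disjoint P Q → IsCompl (P ⊔ Q) C →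
      Nonempty ((M ⧸ P) ≃ₗ[Λ] (Q × C)) := by
    intro P Q hd hC
    have h1 : IsCompl P (Q ⊔ C) :=
      ⟨hd.disjoint_sup_right_of_disjoint_sup_left hC.1, by
        rw [codisjoint_iff, ← sup_assoc]; exact hC.2.eq_top⟩
    have hQC : Disjoint Q C := hC.1.mono_left le_sup_right
    have h3 : Function.Injective (Q.subtype.coprod C.subtype) := by
      rw [← LinearMap.ker_eq_bot, LinearMap.ker_coprod_of_disjoint_range]
      · simp
      · simpa using hQC
    have h4 : LinearMap.range (Q.subtype.coprod C.subtype) = Q ⊔ C := by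
      rw [LinearMap.range_coprod]; simp
    exact ⟨(Submodule.quotientEquivOfIsCompl P (Q ⊔ C) h1).trans
      ((LinearEquiv.ofEq _ _ h4.symm).trans (LinearEquiv.ofInjective _ h3).symm)⟩
  obtain ⟨f1⟩ := key P Q hd hC
  obtain ⟨f2⟩ := key Q P hd.symm (by rwa [sup_comm])
  exact ⟨f1.trans ((e.symm.prodCongr (LinearEquiv.refl _ _)).trans f2.symm)⟩

variable [IsSemisimpleRing Λ]

lemma cancel_simple {S A B : Type} [AddCommGroup S] [Module Λ S] [IsSimpleModule Λ S]
    [AddCommGroup A] [Module Λ A] [AddCommGroup B] [Module Λ B]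
    (e : (S × A) ≃ₗ[Λ] (S × B)) : Nonempty (A ≃ₗ[Λ] B) := by
  let i : S →ₗ[Λ] S × A := LinearMap.inl Λ S A
  let j : S →ₗ[Λ] S × A := e.symm.toLinearMap ∘ₗ LinearMap.inl Λ S B
  have hi : Function.Injective i := LinearMap.inl_injective
  have hj : Function.Injective j := e.symm.injective.comp LinearMap.inl_injective
  let ei := LinearEquiv.ofInjective i hi
  let ej := LinearEquiv.ofInjective j hj
  have : IsSimpleModule Λ (LinearMap.range i) := IsSimpleModule.congr ei.symm
  obtain ⟨f⟩ := quot_equiv_of_simple (LinearMap.range i) (LinearMap.range j) (ei.symm.trans ej)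
  have h1 : LinearMap.ker (LinearMap.snd Λ S A) = LinearMap.range i :=
    (LinearMap.range_inl Λ S A).symm
  have h2 : LinearMap.ker (LinearMap.snd Λ S B ∘ₗ e.toLinearMap) = LinearMap.range j := by
    ext x
    simp only [LinearMap.mem_ker, LinearMap.mem_range, LinearMap.comp_apply, j,
      LinearEquiv.coe_coe, LinearMap.snd_apply]
    constructor
    · intro h
      refine ⟨(e x).1, ?_⟩
      rw [LinearEquiv.symm_apply_eq]
      ext
      · simp
      · simp [h]
    · rintro ⟨y, rfl⟩; simp
  have s1 : Function.Surjective (LinearMap.snd Λ S A) := Prod.snd_surjective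
  have s2 : Function.Surjective (LinearMap.snd Λ S B ∘ₗ e.toLinearMap) :=
    Prod.snd_surjective.comp e.surjective
  exact ⟨((LinearMap.snd Λ S A).quotKerEquivOfSurjective s1).symm.trans
    ((Submodule.quotEquivOfEq _ _ h1).trans (f.trans
      ((Submodule.quotEquivOfEq _ _ h2.symm).trans
        (LinearMap.quotKerEquivOfSurjective _ s2))))⟩

lemma cancel_pi (n : ℕ) : ∀ (S : Fin n → Type) [∀ i, AddCommGroup (S i)] [∀ i, Module Λ (S i)]
    [∀ i, IsSimpleModule Λ (S i)] (A B : Type)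
    [AddCommGroup A] [Module Λ A] [AddCommGroup B] [Module Λ B]
    (_ : ((∀ i, S i) × A) ≃ₗ[Λ] ((∀ i, S i) × B)), Nonempty (A ≃ₗ[Λ] B) := by
  induction n with
  | zero =>
    intro S _ _ _ A B _ _ _ _ e
    exact ⟨(LinearEquiv.uniqueProd (R := Λ) (M := A) (M₂ := ∀ i, S i)).symm.trans (e.trans LinearEquiv.uniqueProd)⟩
  | succ n ih =>
    intro S _ _ _ A B _ _ _ _ e
    have c : ∀ (C : Type) [AddCommGroup C] [Module Λ C],
        ((∀ i, S i) × C) ≃ₗ[Λ] (S 0 × ((∀ i : Fin n, S i.succ) × C)) := fun C _ _ =>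
      ((Fin.consLinearEquiv Λ S).symm.prodCongr (LinearEquiv.refl Λ C)).trans
        (LinearEquiv.prodAssoc Λ _ _ _)
    obtain ⟨f⟩ := cancel_simple ((c A).symm.trans (e.trans (c B)))
    exact ih (fun i => S i.succ) A B f

lemma cancel_fin {S A B : Type} [AddCommGroup S] [Module Λ S] [Module.Finite Λ S]
    [AddCommGroup A] [Module Λ A] [AddCommGroup B] [Module Λ B]
    (e : (S × A) ≃ₗ[Λ] (S × B)) : Nonempty (A ≃ₗ[Λ] B) := by
  obtain ⟨n, T, f, hT⟩ := IsSemisimpleModule.exists_linearEquiv_fin_dfinsupp Λ S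
  let f' : S ≃ₗ[Λ] (∀ i, T i) := f.trans DFinsupp.linearEquivFunOnFintype
  exact cancel_pi n (fun i => T i) A B
    ((f'.symm.prodCongr (LinearEquiv.refl _ _)).trans
      (e.trans (f'.prodCongr (LinearEquiv.refl _ _))))
end Cancel
section Crossed
variable {Λ : Type} [Ring Λ] {P : Type} [Group P] {V : Type} [AddCommGroup V] [Module Λ V]

/-- Crossed homomorphisms. -/
def IsCr (σ : P →* Λ) (f : P → V) : Prop := ∀ a b, f (a * b) = f a + σ a • f b

lemma IsCr.one {σ : P →* Λ} {f : P → V} (h : IsCr σ f) : f 1 = 0 := by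
  have := h 1 1
  simpa using this

lemma IsCr.inv {σ : P →* Λ} {f : P → V} (h : IsCr σ f) (a : P) :
    f a⁻¹ = - (σ a⁻¹ • f a) := by
  have := h a⁻¹ a
  rw [inv_mul_cancel, h.one] at this
  exact eq_neg_of_add_eq_zero_left this.symm

lemma IsCr.ext {σ : P →* Λ} {f f' : P → V} (h : IsCr σ f) (h' : IsCr σ f') {S : Set P}
    (hS : Subgroup.closure S = ⊤) (e : ∀ s ∈ S, f s = f' s) (p : P) : f p = f' p := by
  have hp : p ∈ Subgroup.closure S := by rw [hS]; trivial
  induction hp using Subgroup.closure_induction with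
  | mem x hx => exact e x hx
  | one => rw [h.one, h'.one]
  | mul x y _ _ hx hy => rw [h, h', hx, hy]
  | inv x _ hx => rw [h.inv, h'.inv, hx]

/-- Affine group. -/
@[ext] structure AffGp (Λ V : Type) [Ring Λ] [AddCommGroup V] [Module Λ V] where
  /-- translation part -/
  v : V
  /-- linear part -/
  u : Λˣ

instance : Group (AffGp Λ V) :=
  { mul := fun a b => ⟨a.v + (a.u : Λ) • b.v, a.u * b.u⟩
    one := ⟨0, 1⟩
    inv := fun a => ⟨-((a.u⁻¹ : Λˣ) : Λ) • a.v, a.u⁻¹⟩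
    mul_assoc := fun a b c => by
      refine AffGp.ext ?_ (mul_assoc a.u b.u c.u)
      show (a.v + (a.u : Λ) • b.v) + ((a.u * b.u : Λˣ) : Λ) • c.v
        = a.v + (a.u : Λ) • (b.v + (b.u : Λ) • c.v)
      rw [Units.val_mul, mul_smul, smul_add, add_assoc]
    one_mul := fun a => by
      refine AffGp.ext ?_ (one_mul a.u)
      show (0 : V) + ((1 : Λˣ) : Λ) • a.v = a.v
      simp
    mul_one := fun a => by
      refine AffGp.ext ?_ (mul_one a.u)
      show a.v + (a.u : Λ) • (0 : V) = a.v
      simp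
    inv_mul_cancel := fun a => by
      refine AffGp.ext ?_ (inv_mul_cancel a.u)
      show -((a.u⁻¹ : Λˣ) : Λ) • a.v + ((a.u⁻¹ : Λˣ) : Λ) • a.v = 0
      simp }

lemma exists_cr_free {α : Type} (σ : FreeGroup α →* Λ) (v : α → V) :
    ∃ D : FreeGroup α → V, IsCr σ D ∧ ∀ i, D (FreeGroup.of i) = v i := by
  let H : FreeGroup α →* AffGp Λ V :=
    FreeGroup.lift fun i => ⟨v i, σ.toHomUnits (FreeGroup.of i)⟩
  let pr : AffGp Λ V →* Λˣ := { toFun := fun a => a.u, map_one' := rfl, map_mul' := fun _ _ => rfl }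
  have hpr : pr.comp H = σ.toHomUnits := by
    apply FreeGroup.ext_hom
    intro i
    simp [H, pr]
  refine ⟨fun w => (H w).v, fun a b => ?_, fun i => by simp [H]⟩
  have h1 : (H a).u = σ.toHomUnits a := by rw [← hpr]; rfl
  show (H (a * b)).v = _
  rw [map_mul]
  show (H a).v + ((H a).u : Λ) • (H b).v = _
  rw [h1]; rfl

lemma exists_cr_desc {F : Type} [Group F] (φ : F →* P) (hφ : Function.Surjective φ)
    (r : F) (hr : φ.ker = Subgroup.normalClosure {r}) (σ : P →* Λ) (D : F → V)
    (hD : IsCr (σ.comp φ) D) (hDr : D r = 0) :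
    ∃ d : P → V, IsCr σ d ∧ ∀ a, d (φ a) = D a := by
  let N : Subgroup F :=
    { carrier := {a | φ a = 1 ∧ D a = 0}
      mul_mem' := by
        rintro a b ⟨ha, ha'⟩ ⟨hb, hb'⟩
        exact ⟨by simp [ha, hb], by rw [hD, ha', hb']; simp⟩
      one_mem' := ⟨map_one _, hD.one⟩
      inv_mem' := by
        rintro a ⟨ha, ha'⟩
        exact ⟨by simp [ha], by rw [hD.inv, ha']; simp⟩ }
  have hN : N.Normal := ⟨by
    rintro n ⟨hn, hn'⟩ a
    refine ⟨by simp [hn], ?_⟩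
    rw [hD, hD, hn', hD.inv]
    simp only [MonoidHom.comp_apply, map_mul, hn, smul_zero, add_zero, smul_neg, ← mul_smul]
    simp [← map_mul]⟩
  have hker : ∀ a, φ a = 1 → D a = 0 := by
    intro a ha
    have h1 : Subgroup.normalClosure {r} ≤ N := by
      apply Subgroup.normalClosure_le_normal
      rintro x rfl
      exact ⟨by
        have : x ∈ φ.ker := by rw [hr]; exact Subgroup.subset_normalClosure rfl
        exact this, hDr⟩
    have h2 : a ∈ φ.ker := ha
    rw [hr] at h2
    exact (h1 h2).2
  have hwd : ∀ a b, φ a = φ b → D a = D b := by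
    intro a b h
    have h1 := hD b (b⁻¹ * a)
    rw [mul_inv_cancel_left, hker (b⁻¹ * a) (by simp [h])] at h1
    simpa using h1
  have key : ∀ a, D (Function.surjInv hφ (φ a)) = D a := fun a =>
    hwd _ _ (Function.surjInv_eq hφ _)
  refine ⟨fun p => D (Function.surjInv hφ p), fun a b => ?_, key⟩
  obtain ⟨a, rfl⟩ := hφ a
  obtain ⟨b, rfl⟩ := hφ b
  rw [← map_mul]
  simp only [key]
  rw [hD]; rfl

/-- The universal crossed homomorphism of a one-relator group. -/
lemma exists_universal {α : Type} [Fintype α] [DecidableEq α]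
    (φ : FreeGroup α →* P) (hφ : Function.Surjective φ)
    (r : FreeGroup α) (hr : φ.ker = Subgroup.normalClosure {r}) (σ : P →* Λ)
    (D : FreeGroup α → (α → Λ)) (hD : IsCr (σ.comp φ) D)
    (hDi : ∀ i, D (FreeGroup.of i) = Pi.single i 1) :
    ∃ d : P → ((α → Λ) ⧸ Submodule.span Λ {D r}), IsCr σ d ∧
      (∀ (W : Type) [AddCommGroup W] [Module Λ W] (f : P → W), IsCr σ f →
        ∃ L : ((α → Λ) ⧸ Submodule.span Λ {D r}) →ₗ[Λ] W, ∀ p, L (d p) = f p) ∧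
      (∀ (W : Type) [AddCommGroup W] [Module Λ W]
        (L L' : ((α → Λ) ⧸ Submodule.span Λ {D r}) →ₗ[Λ] W),
        (∀ p, L (d p) = L' (d p)) → L = L') := by
  obtain ⟨d, hd, hdD⟩ := exists_cr_desc φ hφ r hr σ
    (fun a => (Submodule.span Λ {D r}).mkQ (D a))
    (fun a b => by simp only [hD a b, map_add, map_smul])
    (by
      rw [Submodule.mkQ_apply, Submodule.Quotient.mk_eq_zero]
      exact Submodule.mem_span_singleton_self _)
  have hgen : Subgroup.closure (Set.range fun i => φ (FreeGroup.of i)) = ⊤ := by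
    have : (Set.range fun i => φ (FreeGroup.of i)) = φ '' Set.range FreeGroup.of := by
      rw [← Set.range_comp]; rfl
    rw [this, ← MonoidHom.map_closure, FreeGroup.closure_range_of, ← MonoidHom.range_eq_map,
      MonoidHom.range_eq_top]
    exact hφ
  refine ⟨d, hd, ?_, ?_⟩
  · intro W _ _ f hf
    let L0 : (α → Λ) →ₗ[Λ] W := Fintype.linearCombination Λ (fun i => f (φ (FreeGroup.of i)))
    have hL0 : ∀ a, L0 (D a) = f (φ a) := by
      refine IsCr.ext (σ := σ.comp φ) (fun a b => ?_) (fun a b => ?_)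
        (FreeGroup.closure_range_of α) ?_
      · simp only [hD a b, map_add, map_smul]
      · simp only [map_mul, hf _ _, MonoidHom.comp_apply]
      · rintro _ ⟨i, rfl⟩
        simp [L0, hDi, Fintype.linearCombination_apply_single]
    have hle : Submodule.span Λ {D r} ≤ LinearMap.ker L0 := by
      rw [Submodule.span_le, Set.singleton_subset_iff]
      show L0 (D r) = 0
      rw [hL0]
      have : r ∈ φ.ker := by rw [hr]; exact Subgroup.subset_normalClosure rfl
      rw [show φ r = 1 from this, hf.one]
    refine ⟨Submodule.liftQ _ L0 hle, ?_⟩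
    intro p
    obtain ⟨a, rfl⟩ := hφ p
    rw [hdD, Submodule.mkQ_apply, Submodule.liftQ_apply, hL0]
  · intro W _ _ L L' h
    apply Submodule.linearMap_qext
    apply LinearMap.pi_ext'
    intro i
    ext
    have := h (φ (FreeGroup.of i))
    rw [hdD, hDi] at this
    simpa using this
end Crossed
section ClsX
variable (R : Subgroup π) [R.Normal] (k : Type) [Field k]

/-- The class of an element of `R` in `H₁(R;k)`. -/
def cls (r : R) : (conjRep R k).asModule :=
  (conjRep R k).asModuleEquiv.symm (1 ⊗ₜ[ℤ] Additive.ofMul (Abelianization.of r))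

lemma cls_mul (r s : R) : cls R k (r * s) = cls R k r + cls R k s := by
  simp [cls, TensorProduct.tmul_add]

lemma cls_conj (p : π) (r : R) :
    MonoidAlgebra.of k (π ⧸ R) (p : π ⧸ R) • cls R k r = cls R k (MulAut.conjNormal p r) := by
  rw [cls, ← Representation.asModuleEquiv_symm_map_rho]
  rfl

lemma tmul_eq_cls (c : k) (a : Additive (Abelianization R)) :
    ∃ r : R, (conjRep R k).asModuleEquiv.symm (c ⊗ₜ[ℤ] a) = c • cls R k r := by
  obtain ⟨r, hr⟩ := QuotientGroup.mk_surjective (Additive.toMul a)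
  refine ⟨r, ?_⟩
  have ha : a = Additive.ofMul (Abelianization.of r) := hr.symm
  rw [cls, ← map_smul, TensorProduct.smul_tmul', smul_eq_mul, mul_one, ha]

variable {V : Type} [AddCommGroup V] [Module k V] [Module (MonoidAlgebra k (π ⧸ R)) V]
  [IsScalarTower k (MonoidAlgebra k (π ⧸ R)) V]

lemma exists_lift_cls (f : R → V) (hf : ∀ r s, f (r * s) = f r + f s)
    (hc : ∀ (p : π) (r : R), f (MulAut.conjNormal p r) =
      MonoidAlgebra.of k (π ⧸ R) (p : π ⧸ R) • f r) :
    ∃ L : (conjRep R k).asModule →ₗ[MonoidAlgebra k (π ⧸ R)] V, ∀ r, L (cls R k r) = f r := by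
  let f0 : R →* Multiplicative V :=
    MonoidHom.mk' (fun r => Multiplicative.ofAdd (f r)) (fun a b => by rw [hf]; rfl)
  let f1 : Additive (Abelianization R) →ₗ[ℤ] V :=
    (MonoidHom.toAdditiveLeft (Abelianization.lift f0)).toIntLinearMap
  have hf1 : ∀ r : R, f1 (Additive.ofMul (Abelianization.of r)) = f r := fun r => by
    simp only [f1, AddMonoidHom.coe_toIntLinearMap]
    show Multiplicative.toAdd (Abelianization.lift f0 (Abelianization.of r)) = f r
    rw [Abelianization.lift_apply_of]; rfl
  let f2 : (k ⊗[ℤ] Additive (Abelianization R)) →ₗ[k] V := LinearMap.liftBaseChange k f1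
  let f3 : (conjRep R k).asModule →ₗ[k] V := f2 ∘ₗ (conjRep R k).asModuleEquiv.toLinearMap
  have hf3 : ∀ r, f3 (cls R k r) = f r := fun r => by
    simp [f3, f2, cls, hf1]
  refine ⟨MonoidAlgebra.equivariantOfLinearOfComm f3 ?_, fun r => hf3 r⟩
  intro g v
  obtain ⟨p, rfl⟩ := QuotientGroup.mk_surjective g
  obtain ⟨v, rfl⟩ := (conjRep R k).asModuleEquiv.symm.surjective v
  induction v using TensorProduct.induction_on with
  | zero => simp
  | add x y hx hy => rw [map_add, smul_add, map_add, hx, hy, map_add, smul_add]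
  | tmul c a =>
    obtain ⟨r, hr⟩ := tmul_eq_cls R k c a
    have h1 := cls_conj R k p r
    rw [MonoidAlgebra.of_apply] at h1
    rw [hr, smul_comm, h1, map_smul, map_smul, hf3, hf3, hc, smul_comm]
    rfl

lemma ext_cls (L L' : (conjRep R k).asModule →ₗ[MonoidAlgebra k (π ⧸ R)] V)
    (h : ∀ r, L (cls R k r) = L' (cls R k r)) : L = L' := by
  ext v
  obtain ⟨v, rfl⟩ := (conjRep R k).asModuleEquiv.symm.surjective v
  induction v using TensorProduct.induction_on with
  | zero => simp
  | add x y hx hy => rw [map_add, map_add, hx, hy, map_add]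
  | tmul c a =>
    obtain ⟨r, hr⟩ := tmul_eq_cls R k c a
    rw [hr, ← algebraMap_smul (MonoidAlgebra k (π ⧸ R)) c (cls R k r), map_smul, map_smul, h]
end ClsX

section PartA
variable (R : Subgroup π) [R.Normal] (k : Type) [Field k]

lemma exists_avg [Fintype (π ⧸ R)] [CharZero k] :
    ∃ Φ : π → (conjRep R k).asModule,
      IsCr ((MonoidAlgebra.of k (π ⧸ R)).comp (QuotientGroup.mk' R)) Φ ∧
      ∀ r : R, Φ r = cls R k r := by
  let s : π ⧸ R → π := Quotient.out
  have hs : ∀ h, (s h : π ⧸ R) = h := QuotientGroup.out_eq'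
  have hmem : ∀ (p : π) (h : π ⧸ R), p * s h * (s ((p : π ⧸ R) * h))⁻¹ ∈ R := by
    intro p h
    rw [← QuotientGroup.eq_one_iff]
    simp [hs]
  let c : π → π ⧸ R → R := fun p h => ⟨_, hmem p h⟩
  have hc : ∀ p q h, c (p * q) h = MulAut.conjNormal p (c q h) * c p ((q : π ⧸ R) * h) := by
    intro p q h
    ext
    simp [c, mul_assoc]
  have hn : (Fintype.card (π ⧸ R) : k) ≠ 0 := by
    exact_mod_cast Fintype.card_ne_zero
  refine ⟨fun p => (Fintype.card (π ⧸ R) : k)⁻¹ • ∑ h, cls R k (c p h), ?_, ?_⟩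
  · intro p q
    simp only [hc, cls_mul, Finset.sum_add_distrib, smul_add, ← cls_conj]
    rw [add_comm]
    congr 1
    · congr 1
      exact Fintype.sum_equiv (Equiv.mulLeft (q : π ⧸ R)) _ _ (fun _ => rfl)
    · rw [← Finset.smul_sum, smul_comm]; rfl
  · intro r
    have : ∀ h, c r h = r := by
      intro h
      have : ((r : π) : π ⧸ R) = 1 := (QuotientGroup.eq_one_iff _).2 r.2
      ext
      simp [c, this]
    simp only [this, Finset.sum_const, Finset.card_univ]
    rw [← Nat.cast_smul_eq_nsmul k, smul_smul, inv_mul_cancel₀ hn, one_smul]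

/-- The norm element. -/
def nrm (k G : Type) [Field k] [Group G] [Fintype G] : MonoidAlgebra k G :=
  ∑ g, MonoidAlgebra.of k G g

lemma of_mul_nrm {k G : Type} [Field k] [Group G] [Fintype G] (g : G) :
    MonoidAlgebra.of k G g * nrm k G = nrm k G := by
  rw [nrm, Finset.mul_sum]
  simp only [← map_mul]
  exact Fintype.sum_equiv (Equiv.mulLeft g) _ _ (fun _ => rfl)

lemma nrm_mul_of {k G : Type} [Field k] [Group G] [Fintype G] (g : G) :
    nrm k G * MonoidAlgebra.of k G g = nrm k G := by
  rw [nrm, Finset.sum_mul]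
  simp only [← map_mul]
  exact Fintype.sum_equiv (Equiv.mulRight g) _ _ (fun _ => rfl)

lemma nrm_apply {k G : Type} [Field k] [Group G] [Fintype G] (g : G) :
    (nrm k G).coeff g = 1 := by
  classical
  simp [nrm]

lemma nrm_ne_zero {k G : Type} [Field k] [Group G] [Fintype G] : nrm k G ≠ 0 := by
  intro h
  have := nrm_apply (k := k) (1 : G)
  rw [h] at this
  simp at this

lemma nrm_mul_nrm {k G : Type} [Field k] [Group G] [Fintype G] :
    nrm k G * nrm k G = (Fintype.card G : k) • nrm k G := by
  conv_lhs => lhs; rw [nrm]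
  rw [Finset.sum_mul]
  simp only [of_mul_nrm, Finset.sum_const, Finset.card_univ]
  rw [Nat.cast_smul_eq_nsmul]

theorem partA [Fintype (π ⧸ R)] [CharZero k] {M : Type} [AddCommGroup M] [Module k M]
    [Module (MonoidAlgebra k (π ⧸ R)) M] [IsScalarTower k (MonoidAlgebra k (π ⧸ R)) M]
    (d : π → M) (hd : IsCr ((MonoidAlgebra.of k (π ⧸ R)).comp (QuotientGroup.mk' R)) d)
    (huniv : ∀ (W : Type) [AddCommGroup W] [Module (MonoidAlgebra k (π ⧸ R)) W] (f : π → W),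
      IsCr ((MonoidAlgebra.of k (π ⧸ R)).comp (QuotientGroup.mk' R)) f →
        ∃ L : M →ₗ[MonoidAlgebra k (π ⧸ R)] W, ∀ p, L (d p) = f p)
    (hext : ∀ (W : Type) [AddCommGroup W] [Module (MonoidAlgebra k (π ⧸ R)) W]
        (L L' : M →ₗ[MonoidAlgebra k (π ⧸ R)] W), (∀ p, L (d p) = L' (d p)) → L = L')
    (K : Submodule (MonoidAlgebra k (π ⧸ R)) (MonoidAlgebra k (π ⧸ R)))
    (hK : ∀ a, a ∈ K ↔ ∃ c : k, a = c • nrm k (π ⧸ R)) :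
    Nonempty ((M × K) ≃ₗ[MonoidAlgebra k (π ⧸ R)]
      ((conjRep R k).asModule × MonoidAlgebra k (π ⧸ R))) := by
  set Λ := MonoidAlgebra k (π ⧸ R) with hΛ
  set N := nrm k (π ⧸ R) with hN
  set n : k := (Fintype.card (π ⧸ R) : k) with hn
  have hn0 : n ≠ 0 := Nat.cast_ne_zero.2 Fintype.card_ne_zero
  let σ : π →* Λ := (MonoidAlgebra.of k (π ⧸ R)).comp (QuotientGroup.mk' R)
  have hσR : ∀ r : R, σ r = 1 := fun r => by
    have : ((r : π) : π ⧸ R) = 1 := (QuotientGroup.eq_one_iff _).2 r.2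
    show MonoidAlgebra.of k (π ⧸ R) ((r : π) : π ⧸ R) = 1
    rw [this, map_one]
  obtain ⟨Φ, hΦ, hΦR⟩ := exists_avg R k
  obtain ⟨ρ, hρ⟩ := huniv _ Φ hΦ
  obtain ⟨ε, hε⟩ := huniv Λ (fun p => σ p - 1) (fun a b => by
    show σ (a * b) - 1 = σ a - 1 + σ a • (σ b - 1)
    rw [map_mul, smul_eq_mul, mul_sub, mul_one]; abel)
  obtain ⟨ι, hι⟩ := exists_lift_cls R k (V := M) (fun r => d r)
    (fun r s => by
      show d ((r : π) * s) = _
      rw [hd]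
      show _ + σ r • _ = _
      rw [hσR, one_smul])
    (fun p r => by
      show d _ = σ p • d r
      rw [MulAut.conjNormal_apply, hd, hd, hd.inv]
      show d p + σ p • d r + σ (p * r) • -(σ p⁻¹ • d p) = _
      rw [smul_neg, ← mul_smul, ← map_mul,
        show (p : π) * r * p⁻¹ = ((MulAut.conjNormal p r : R) : π) by simp, hσR, one_smul]
      abel)
  have hρι : ∀ x, ρ (ι x) = x := by
    have : ρ ∘ₗ ι = LinearMap.id := ext_cls R k _ _ (fun r => by simp [hι, hρ, hΦR])
    exact fun x => LinearMap.congr_fun this x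
  have hει : ∀ x, ε (ι x) = 0 := by
    have : ε ∘ₗ ι = 0 := ext_cls R k _ _ (fun r => by simp [hι, hε, hσR])
    exact fun x => LinearMap.congr_fun this x
  -- the difference crossed homomorphism
  let δ : π → M := fun p => d p - ι (Φ p)
  have hδ : IsCr σ δ := fun a b => by
    have h1 : d (a * b) = d a + σ a • d b := hd a b
    have h2 : Φ (a * b) = Φ a + σ a • Φ b := hΦ a b
    show d (a * b) - ι (Φ (a * b)) = d a - ι (Φ a) + σ a • (d b - ι (Φ b))
    rw [h1, h2, map_add, map_smul, smul_sub]; abel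
  have hδR : ∀ r : R, δ r = 0 := fun r => by simp [δ, hΦR, hι]
  let s : π ⧸ R → π := Quotient.out
  have hs : ∀ h, (s h : π ⧸ R) = h := QuotientGroup.out_eq'
  have hδs : ∀ p : π, δ (s (p : π ⧸ R)) = δ p := by
    intro p
    have hm : p⁻¹ * s (p : π ⧸ R) ∈ R := by
      rw [← QuotientGroup.eq_one_iff]; simp [hs]
    have := hδ p (p⁻¹ * s (p : π ⧸ R))
    rw [mul_inv_cancel_left, hδR ⟨_, hm⟩, smul_zero, add_zero] at this
    exact this
  let v : M := - (n⁻¹ • ∑ h, δ (s h))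
  have hsum : ∀ p, ∑ h, δ (s h) = n • δ p + σ p • ∑ h, δ (s h) := by
    intro p
    have h1 : ∑ h, δ (s h) = ∑ h, δ (s ((p : π ⧸ R) * h)) :=
      (Fintype.sum_equiv (Equiv.mulLeft (p : π ⧸ R)) _ _ (fun _ => rfl)).symm
    have h2 : ∀ h, δ (s ((p : π ⧸ R) * h)) = δ p + σ p • δ (s h) := by
      intro h
      rw [← hδ, ← hδs (p * s h)]
      simp [hs]
    conv_lhs => rw [h1]
    simp only [h2, Finset.sum_add_distrib, Finset.sum_const, Finset.card_univ, Finset.smul_sum]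
    rw [← Nat.cast_smul_eq_nsmul k]
  have hv : ∀ p, δ p = (σ p - 1) • v := by
    intro p
    have h := hsum p
    have : n • δ p = (1 - σ p) • ∑ h, δ (s h) := by
      rw [sub_smul, one_smul]; exact eq_sub_of_add_eq h.symm
    have h3 : δ p = n⁻¹ • (1 - σ p) • ∑ h, δ (s h) := by
      rw [← this, smul_smul, inv_mul_cancel₀ hn0, one_smul]
    rw [h3, smul_comm]
    show _ = (σ p - 1) • -(n⁻¹ • ∑ h, δ (s h))
    rw [smul_neg, ← neg_smul, neg_sub]
  have hid : ∀ m, m = ι (ρ m) + ε m • v := by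
    have : LinearMap.id = ι ∘ₗ ρ + (LinearMap.toSpanSingleton Λ M v) ∘ₗ ε := by
      apply hext
      intro p
      have := hv p
      simp only [δ] at this
      simp [hρ, hε, ← this]
    exact fun m => LinearMap.congr_fun this m
  have hρv : ρ v = 0 := by
    have : ∀ p, ρ (δ p) = 0 := fun p => by simp [δ, hρι, hρ]
    simp only [v, map_neg]
    rw [← algebraMap_smul Λ n⁻¹ (∑ h, δ (s h)), map_smul, map_sum]
    simp [this]
  have hεv : ε v = 1 - n⁻¹ • N := by
    have h1 : ∀ h, ε (δ (s h)) = MonoidAlgebra.of k _ h - 1 := fun h => by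
      simp only [δ, map_sub, hει, hε, sub_zero]
      show MonoidAlgebra.of k (π ⧸ R) ((s h : π ⧸ R)) - 1 = _
      rw [hs]
    simp only [v, map_neg]
    rw [← algebraMap_smul Λ n⁻¹ (∑ h, δ (s h)), map_smul, map_sum]
    simp only [h1, Finset.sum_sub_distrib, Finset.sum_const, Finset.card_univ, algebraMap_smul]
    rw [← Nat.cast_smul_eq_nsmul k, smul_sub, smul_smul, inv_mul_cancel₀ hn0, one_smul, neg_sub]
    rfl
  have hεN : ∀ m, ε m * N = 0 := by
    have : (LinearMap.toSpanSingleton Λ Λ N) ∘ₗ ε = 0 := by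
      apply hext
      intro p
      have : σ p * N = N := of_mul_nrm _
      simp [hε, sub_mul, this]
    exact fun m => LinearMap.congr_fun this m
  have hNK : N ∈ K := (hK N).2 ⟨1, (one_smul _ _).symm⟩
  have hnN : n⁻¹ • N ∈ K := (hK _).2 ⟨n⁻¹, rfl⟩
  let Ψ : (M × K) →ₗ[Λ] ((conjRep R k).asModule × Λ) :=
    LinearMap.prod (ρ ∘ₗ LinearMap.fst Λ M K) (ε.coprod K.subtype)
  refine ⟨LinearEquiv.ofBijective Ψ ⟨?_, ?_⟩⟩
  · rw [injective_iff_map_eq_zero]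
    rintro ⟨m, ⟨a, ha⟩⟩ h
    have h1 : ρ m = 0 := congrArg Prod.fst h
    have h2 : ε m + a = 0 := congrArg Prod.snd h
    obtain ⟨c, rfl⟩ := (hK a).1 ha
    have h3 : (ε m + c • N) * N = 0 := by rw [h2, zero_mul]
    rw [add_mul, hεN, zero_add, smul_mul_assoc, nrm_mul_nrm, smul_smul] at h3
    have hc : c = 0 := by
      rcases smul_eq_zero.1 h3 with h4 | h4
      · exact (mul_eq_zero.1 h4).resolve_right hn0
      · exact absurd h4 nrm_ne_zero
    subst hc
    rw [zero_smul, add_zero] at h2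
    have hm : m = 0 := by rw [hid m, h1, h2]; simp
    subst hm
    simp
  · rintro ⟨x, l⟩
    refine ⟨(ι x + l • v, l • ⟨n⁻¹ • N, hnN⟩), ?_⟩
    refine Prod.ext ?_ ?_
    · show ρ (ι x + l • v) = x
      rw [map_add, map_smul, hρι, hρv, smul_zero, add_zero]
    · show ε (ι x + l • v) + l • (n⁻¹ • N) = l
      rw [map_add, map_smul, hει, hεv, zero_add, ← smul_add, sub_add_cancel, smul_eq_mul, mul_one]
end PartA
section PartB
variable {k G : Type} [Field k] [Group G] [Fintype G]

lemma fix_of_comm (a : MonoidAlgebra k G) (x y : G)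
    (h1 : a * (1 - MonoidAlgebra.of k G (x * y * x⁻¹)) = 0)
    (h2 : a * (MonoidAlgebra.of k G x - MonoidAlgebra.of k G (x * y * x⁻¹ * y⁻¹)) = 0) :
    a * MonoidAlgebra.of k G x = a ∧ a * MonoidAlgebra.of k G y = a := by
  have mv : ∀ {b c : MonoidAlgebra k G} (g : G), b = c →
      b * MonoidAlgebra.of k G g = c * MonoidAlgebra.of k G g := fun g h => by rw [h]
  rw [mul_sub, mul_one, sub_eq_zero] at h1
  rw [mul_sub, sub_eq_zero, map_mul _ _ y⁻¹, ← mul_assoc, ← h1] at h2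
  -- a x = a y⁻¹
  have h3 := mv y h2
  rw [mul_assoc, mul_assoc, ← map_mul, ← map_mul, inv_mul_cancel, map_one, mul_one] at h3
  -- a (x y) = a
  rw [map_mul _ (x * y), ← mul_assoc, h3] at h1
  have h4 := mv x h1
  rw [mul_assoc, ← map_mul, inv_mul_cancel, map_one, mul_one] at h4
  refine ⟨h4, ?_⟩
  rw [map_mul, ← mul_assoc, h4] at h3
  exact h3

lemma fix_of_rel {g : ℕ} (q : FreeGroup (Fin g × Bool) →* G)
    (D : FreeGroup (Fin g × Bool) → (Fin g × Bool → MonoidAlgebra k G))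
    (hD : IsCr ((MonoidAlgebra.of k G).comp q) D)
    (hDi : ∀ i, D (FreeGroup.of i) = Pi.single i 1)
    (a : MonoidAlgebra k G) :
    ∀ l : List (Fin g), l.Nodup →
    a • D ((l.map fun i => FreeGroup.of (i, false) * FreeGroup.of (i, true) *
      (FreeGroup.of (i, false))⁻¹ * (FreeGroup.of (i, true))⁻¹).prod) = 0 →
    ∀ i ∈ l, a * MonoidAlgebra.of k G (q (FreeGroup.of (i, false))) = a ∧
      a * MonoidAlgebra.of k G (q (FreeGroup.of (i, true))) = a := by
  have hc : ∀ i, D (FreeGroup.of (i, false) * FreeGroup.of (i, true) *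
      (FreeGroup.of (i, false))⁻¹ * (FreeGroup.of (i, true))⁻¹) =
      Pi.single (i, false) (1 - MonoidAlgebra.of k G (q (FreeGroup.of (i, false)) *
        q (FreeGroup.of (i, true)) * (q (FreeGroup.of (i, false)))⁻¹)) +
      Pi.single (i, true) (MonoidAlgebra.of k G (q (FreeGroup.of (i, false))) -
        MonoidAlgebra.of k G (q (FreeGroup.of (i, false)) *
        q (FreeGroup.of (i, true)) * (q (FreeGroup.of (i, false)))⁻¹ *
        (q (FreeGroup.of (i, true)))⁻¹)) := by
    intro i
    rw [hD, hD, hD, hD.inv, hD.inv, hDi, hDi, smul_neg, smul_neg, ← mul_smul, ← mul_smul,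
      ← map_mul, ← map_mul]
    simp only [← Pi.single_smul, smul_eq_mul, mul_one, Pi.single_sub, MonoidHom.comp_apply,
      map_mul q, map_inv q]
    simp only [mul_assoc]
    abel
  have hsupp : ∀ (l : List (Fin g)) (j : Fin g) (b : Bool), j ∉ l →
      D ((l.map fun i => FreeGroup.of (i, false) * FreeGroup.of (i, true) *
      (FreeGroup.of (i, false))⁻¹ * (FreeGroup.of (i, true))⁻¹).prod) (j, b) = 0 := by
    intro l j b
    induction l with
    | nil => intro _; simp [hD.one]
    | cons i t ih =>
      intro h
      rw [List.mem_cons, not_or] at h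
      rw [List.map_cons, List.prod_cons, hD, Pi.add_apply, Pi.smul_apply, ih h.2, hc]
      simp [h.1]
  intro l
  induction l with
  | nil => intro _ _ i hi; simp at hi
  | cons j t ih =>
    intro hnd h
    rw [List.nodup_cons] at hnd
    rw [List.map_cons, List.prod_cons, hD] at h
    have e1 := congrFun h (j, false)
    have e2 := congrFun h (j, true)
    rw [Pi.smul_apply, Pi.add_apply, Pi.smul_apply, hsupp t j _ hnd.1, hc] at e1 e2
    have hj := fix_of_comm a (q (FreeGroup.of (j, false))) (q (FreeGroup.of (j, true)))
      (by simpa [Pi.single_apply] using e1) (by simpa [Pi.single_apply] using e2)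
    have hinv : ∀ g : G, a * MonoidAlgebra.of k G g = a → a * MonoidAlgebra.of k G g⁻¹ = a := by
      intro g hg
      conv_lhs => rw [← hg]
      rw [mul_assoc, ← map_mul, mul_inv_cancel, map_one, mul_one]
    have h0 : a • D (FreeGroup.of (j, false) * FreeGroup.of (j, true) *
      (FreeGroup.of (j, false))⁻¹ * (FreeGroup.of (j, true))⁻¹) = 0 := by
      rw [hc, smul_add, ← Pi.single_smul, ← Pi.single_smul]
      simp only [smul_eq_mul, mul_sub, map_mul, ← mul_assoc, hj.1, hj.2, hinv _ hj.1,
        hinv _ hj.2, mul_one, sub_self, Pi.single_zero, add_zero]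
    have ht := ih hnd.2 (by
      rw [smul_add, h0, zero_add, smul_smul] at h
      have : a * ((MonoidAlgebra.of k G).comp q) (FreeGroup.of (j, false) * FreeGroup.of (j, true) *
        (FreeGroup.of (j, false))⁻¹ * (FreeGroup.of (j, true))⁻¹) = a := by
        simp only [MonoidHom.comp_apply, map_mul, map_inv q, ← mul_assoc, hj.1, hj.2, hinv _ hj.1,
          hinv _ hj.2]
      rwa [this] at h)
    intro i hi
    rcases List.mem_cons.1 hi with rfl | hi
    · exact hj
    · exact ht i hi

lemma ker_rel {g : ℕ} (q : FreeGroup (Fin g × Bool) →* G) (hq : Function.Surjective q)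
    (D : FreeGroup (Fin g × Bool) → (Fin g × Bool → MonoidAlgebra k G))
    (hD : IsCr ((MonoidAlgebra.of k G).comp q) D)
    (hDi : ∀ i, D (FreeGroup.of i) = Pi.single i 1)
    (a : MonoidAlgebra k G) :
    a • D (surfaceRelator g) = 0 ↔ ∃ c : k, a = c • nrm k G := by
  constructor
  · intro h
    rw [surfaceRelator, List.ofFn_eq_map] at h
    have h1 := fix_of_rel q D hD hDi a (List.finRange g) (List.nodup_finRange g) h
    have h2 : ∀ w, a * MonoidAlgebra.of k G (q w) = a := by
      intro w
      have hw : w ∈ Subgroup.closure (Set.range (FreeGroup.of (α := Fin g × Bool))) := by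
        rw [FreeGroup.closure_range_of]; trivial
      induction hw using Subgroup.closure_induction with
      | mem x hx =>
        obtain ⟨⟨i, b⟩, rfl⟩ := hx
        cases b
        · exact (h1 i (List.mem_finRange i)).1
        · exact (h1 i (List.mem_finRange i)).2
      | one => rw [map_one, map_one, mul_one]
      | mul x y _ _ hx hy => rw [map_mul, map_mul, ← mul_assoc, hx, hy]
      | inv x _ hx =>
        conv_lhs => rw [← hx]
        rw [mul_assoc, ← map_mul, ← map_mul, mul_inv_cancel, map_one, map_one, mul_one]
    refine ⟨a.coeff 1, ?_⟩
    ext y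
    obtain ⟨w, rfl⟩ := hq y
    have h3 := congrArg (fun b => b.coeff (q w)) (h2 w)
    simp only [MonoidAlgebra.of_apply] at h3
    rw [MonoidAlgebra.coeff_smul, Finsupp.smul_apply, nrm_apply, ← h3]
    simp
  · rintro ⟨c, rfl⟩
    let f : FreeGroup (Fin g × Bool) →* Multiplicative (Fin g × Bool → MonoidAlgebra k G) :=
      MonoidHom.mk' (fun w => Multiplicative.ofAdd (nrm k G • D w)) (fun x y => by
        rw [hD, smul_add, smul_smul, MonoidHom.comp_apply, nrm_mul_of]; rfl)
    have hf : f = FreeGroup.lift (fun i => f (FreeGroup.of i)) := by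
      apply FreeGroup.ext_hom; intro i; simp
    have : f (surfaceRelator g) = 1 := by rw [hf]; exact lift_surfaceRelator _ _
    have h2 : nrm k G • D (surfaceRelator g) = 0 := this
    rw [smul_assoc, h2, smul_zero]

end PartB
section Assemble

lemma triv_equiv {k G : Type} [Field k] [Group G] [Fintype G]
    (K : Submodule (MonoidAlgebra k G) (MonoidAlgebra k G))
    (hK : ∀ a, a ∈ K ↔ ∃ c : k, a = c • nrm k G) :
    Nonempty ((Representation.trivial k (G := G) (V := Fin 2 → k)).asModule
      ≃ₗ[MonoidAlgebra k G] (K × K)) := by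
  have hm : ∀ c : k, c • nrm k G ∈ K := fun c => (hK _).2 ⟨c, rfl⟩
  let f : (Representation.trivial k (G := G) (V := Fin 2 → k)).asModule →ₗ[k] (K × K) :=
    { toFun := fun v => (⟨_, hm ((Representation.asModuleEquiv _ v) 0)⟩,
        ⟨_, hm ((Representation.asModuleEquiv _ v) 1)⟩)
      map_add' := fun v w => by ext <;> simp [add_smul]
      map_smul' := fun c v => by ext <;> simp [mul_smul] }
  let f' := MonoidAlgebra.equivariantOfLinearOfComm f (fun (g : G) v => by
    have h1 : MonoidAlgebra.single g (1 : k) • v = v := by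
      rw [Representation.single_smul, one_smul]; rfl
    have h2 : ∀ a : K, MonoidAlgebra.single g (1 : k) • a = a := by
      rintro ⟨a, ha⟩
      obtain ⟨c, rfl⟩ := (hK a).1 ha
      apply Subtype.ext
      show MonoidAlgebra.of k G g • (c • nrm k G) = c • nrm k G
      rw [smul_comm, smul_eq_mul, of_mul_nrm]
    rw [h1]
    exact Prod.ext (h2 _).symm (h2 _).symm)
  have hinj : ∀ c c' : k, c • nrm k G = c' • nrm k G → c = c' := fun c c' h =>
    smul_left_injective k nrm_ne_zero h
  refine ⟨LinearEquiv.ofBijective f' ⟨?_, ?_⟩⟩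
  · intro v w h
    have h1 := hinj _ _ (congrArg (fun x : K × K => (x.1 : MonoidAlgebra k G)) h)
    have h2 := hinj _ _ (congrArg (fun x : K × K => (x.2 : MonoidAlgebra k G)) h)
    apply (Representation.asModuleEquiv _).injective
    ext i
    fin_cases i
    · exact h1
    · exact h2
  · rintro ⟨⟨a, ha⟩, ⟨b, hb⟩⟩
    obtain ⟨c, rfl⟩ := (hK a).1 ha
    obtain ⟨e, rfl⟩ := (hK b).1 hb
    exact ⟨(Representation.asModuleEquiv _).symm ![c, e], rfl⟩

lemma split_equiv {Λ E : Type} [Ring Λ] [IsSemisimpleRing Λ] [AddCommGroup E] [Module Λ E] (w : E) :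
    Nonempty ((E × LinearMap.ker (LinearMap.toSpanSingleton Λ E w)) ≃ₗ[Λ]
      ((E ⧸ Submodule.span Λ {w}) × Λ)) := by
  obtain ⟨C, hC⟩ := exists_isCompl (Submodule.span Λ {w})
  obtain ⟨C', hC'⟩ := exists_isCompl (LinearMap.ker (LinearMap.toSpanSingleton Λ E w))
  -- `E ≃ span × quotient`
  let e1 : E ≃ₗ[Λ] (Submodule.span Λ {w} × (E ⧸ Submodule.span Λ {w})) :=
    (Submodule.prodEquivOfIsCompl _ _ hC).symm.trans
      ((LinearEquiv.refl Λ _).prodCongr (Submodule.quotientEquivOfIsCompl _ _ hC).symm)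
  -- `Λ ≃ ker × span`
  let e3 : C' ≃ₗ[Λ] Submodule.span Λ {w} :=
    (Submodule.quotientEquivOfIsCompl _ _ hC').symm.trans
      ((LinearMap.quotKerEquivRange (LinearMap.toSpanSingleton Λ E w)).trans
        (LinearEquiv.ofEq _ _ (LinearMap.range_toSpanSingleton w)))
  let e2 : Λ ≃ₗ[Λ] (LinearMap.ker (LinearMap.toSpanSingleton Λ E w) × Submodule.span Λ {w}) :=
    (Submodule.prodEquivOfIsCompl _ _ hC').symm.trans ((LinearEquiv.refl Λ _).prodCongr e3)
  let S := Submodule.span Λ {w}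
  let K := LinearMap.ker (LinearMap.toSpanSingleton Λ E w)
  let Q := E ⧸ Submodule.span Λ {w}
  let c1 : (E × K) ≃ₗ[Λ] ((S × Q) × K) := e1.prodCongr (LinearEquiv.refl Λ K)
  let c2 : ((S × Q) × K) ≃ₗ[Λ] ((Q × S) × K) :=
    (LinearEquiv.prodComm Λ S Q).prodCongr (LinearEquiv.refl Λ K)
  let c3 : ((Q × S) × K) ≃ₗ[Λ] (Q × (S × K)) := LinearEquiv.prodAssoc Λ Q S K
  let c4 : (Q × (S × K)) ≃ₗ[Λ] (Q × (K × S)) :=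
    (LinearEquiv.refl Λ Q).prodCongr (LinearEquiv.prodComm Λ S K)
  let c5 : (Q × (K × S)) ≃ₗ[Λ] (Q × Λ) := (LinearEquiv.refl Λ Q).prodCongr e2.symm
  exact ⟨c1.trans (c2.trans (c3.trans (c4.trans c5)))⟩

lemma assemble (g : ℕ) (hg : 2 ≤ g) {Λ : Type} [Ring Λ] [IsSemisimpleRing Λ]
    (w : Fin g × Bool → Λ)
    {X T : Type} [AddCommGroup X] [Module Λ X] [AddCommGroup T] [Module Λ T]
    (eT : T ≃ₗ[Λ] (LinearMap.ker (LinearMap.toSpanSingleton Λ _ w) ×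
      LinearMap.ker (LinearMap.toSpanSingleton Λ _ w)))
    (eA : (((Fin g × Bool → Λ) ⧸ Submodule.span Λ {w}) ×
      LinearMap.ker (LinearMap.toSpanSingleton Λ _ w)) ≃ₗ[Λ] (X × Λ)) :
    Nonempty (X ≃ₗ[Λ] (T × (Fin (2 * g - 2) → Λ))) := by
  obtain ⟨eS⟩ := split_equiv (Λ := Λ) w
  let K := LinearMap.ker (LinearMap.toSpanSingleton Λ _ w)
  let Q := (Fin g × Bool → Λ) ⧸ Submodule.span Λ {w}
  have hcard : Fintype.card (Fin g × Bool) = Fintype.card (Fin 2 ⊕ Fin (2 * g - 2)) := by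
    simp; omega
  let eE : (Fin g × Bool → Λ) ≃ₗ[Λ] ((Fin 2 → Λ) × (Fin (2 * g - 2) → Λ)) :=
    (LinearEquiv.funCongrLeft Λ Λ (Fintype.equivOfCardEq hcard).symm).trans
      (LinearEquiv.sumArrowLequivProdArrow (Fin 2) (Fin (2 * g - 2)) Λ Λ)
  let e2 : (Fin 2 → Λ) ≃ₗ[Λ] (Λ × Λ) := LinearEquiv.finTwoArrow Λ Λ
  -- the big isomorphism
  let b1 : ((Fin 2 → Λ) × X) ≃ₗ[Λ] ((X × Λ) × Λ) :=
    (e2.prodCongr (LinearEquiv.refl Λ X)).trans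
      ((LinearEquiv.prodComm Λ _ _).trans (LinearEquiv.prodAssoc Λ _ _ _).symm)
  let b2 : ((X × Λ) × Λ) ≃ₗ[Λ] ((Q × K) × Λ) := eA.symm.prodCongr (LinearEquiv.refl Λ Λ)
  let b3 : ((Q × K) × Λ) ≃ₗ[Λ] ((Q × Λ) × K) :=
    (LinearEquiv.prodAssoc Λ _ _ _).trans
      (((LinearEquiv.refl Λ Q).prodCongr (LinearEquiv.prodComm Λ K Λ)).trans
        (LinearEquiv.prodAssoc Λ _ _ _).symm)
  let b4 : ((Q × Λ) × K) ≃ₗ[Λ] ((Fin g × Bool → Λ) × (K × K)) :=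
    (eS.symm.prodCongr (LinearEquiv.refl Λ K)).trans (LinearEquiv.prodAssoc Λ _ _ _)
  let b5 : ((Fin g × Bool → Λ) × (K × K)) ≃ₗ[Λ]
      ((Fin 2 → Λ) × (T × (Fin (2 * g - 2) → Λ))) :=
    (eE.prodCongr eT.symm).trans
      ((LinearEquiv.prodAssoc Λ _ _ _).trans
        ((LinearEquiv.refl Λ _).prodCongr (LinearEquiv.prodComm Λ _ _)))
  exact cancel_fin (b1.trans (b2.trans (b3.trans (b4.trans b5))))
end Assemble

/-- Lemma 10b: for a finite-index normal subgroup R of the surface group π₁Σ_g (g ≥ 2) and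
a field k of characteristic 0, H₁(R;k) with the conjugation action of G = π₁Σ_g ⧸ R is
isomorphic as a k[G]-module to k² ⊕ k[G]^{2g-2}, with k² the trivial module. -/
theorem cover_homology_module_surface (g : ℕ) (hg : 2 ≤ g)
    (R : Subgroup (SurfaceGroup g)) [R.Normal] (hfi : R.FiniteIndex)
    (k : Type) [Field k] [CharZero k] :
    Nonempty ((conjRep R k).asModule ≃ₗ[MonoidAlgebra k (SurfaceGroup g ⧸ R)]
      ((Representation.trivial k (G := SurfaceGroup g ⧸ R) (V := Fin 2 → k)).asModule ×
        (Fin (2 * g - 2) → MonoidAlgebra k (SurfaceGroup g ⧸ R)))) := by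
  have := hfi
  have : Finite (SurfaceGroup g ⧸ R) := Subgroup.finite_quotient_of_finiteIndex
  let _ : Fintype (SurfaceGroup g ⧸ R) := Fintype.ofFinite _
  have : NeZero (Nat.card (SurfaceGroup g ⧸ R) : k) :=
    ⟨Nat.cast_ne_zero.2 Nat.card_pos.ne'⟩
  let φ : FreeGroup (Fin g × Bool) →* SurfaceGroup g := PresentedGroup.mk {surfaceRelator g}
  have hφ : Function.Surjective φ := PresentedGroup.mk_surjective _
  have hker : φ.ker = Subgroup.normalClosure {surfaceRelator g} := QuotientGroup.ker_mk' _
  let σ : SurfaceGroup g →* MonoidAlgebra k (SurfaceGroup g ⧸ R) :=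
    (MonoidAlgebra.of k (SurfaceGroup g ⧸ R)).comp (QuotientGroup.mk' R)
  obtain ⟨D, hD, hDi⟩ := exists_cr_free (σ.comp φ)
    (fun i : Fin g × Bool => (Pi.single i 1 : Fin g × Bool → MonoidAlgebra k (SurfaceGroup g ⧸ R)))
  obtain ⟨d, hd, huniv, hext⟩ := exists_universal φ hφ _ hker σ D hD hDi
  have hK := ker_rel ((QuotientGroup.mk' R).comp φ) ((QuotientGroup.mk'_surjective R).comp hφ)
    D hD hDi
  obtain ⟨eA⟩ := partA R k d hd huniv hext
    (LinearMap.ker (LinearMap.toSpanSingleton (MonoidAlgebra k (SurfaceGroup g ⧸ R)) _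
      (D (surfaceRelator g)))) hK
  obtain ⟨eT⟩ := triv_equiv (LinearMap.ker (LinearMap.toSpanSingleton
    (MonoidAlgebra k (SurfaceGroup g ⧸ R)) _ (D (surfaceRelator g)))) hK
  exact assemble g hg (D (surfaceRelator g)) eT eA
end
end

section
/- Let r be an odd prime, let k ≥ 1, and let S = (ℤ/r)[A,B]/(A^{r^k+1}, A^{r^k}·B, B²) be the quotient of the polynomial ring in two commuting variables A, B over 𝔽_r = ℤ/r. Let 𝓗 = ℍ[S] be the quaternion algebra over S (with the standard relations i² = j² = −1, i·j = k = −j·i), and let M be the ideal of 𝓗 generated by A and B. Then there exists a group homomorphism τ : π₁Σ₂ → 𝓗ˣ from the surface group of genus 2 to the group of units of 𝓗 such that τ(x₁) ≡ 1 + A·i, τ(y₁) ≡ 1 + B·j, τ(x₂) ≡ 1 + A·j, and τ(y₂) ≡ 1 + B·i, all modulo M². -/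
open scoped Quaternion

noncomputable section

/-- The ring S = 𝔽_r[A,B]/(A^{r^k+1}, A^{r^k}B, B²), with A = X 0 and B = X 1. -/
def Sring (r k : ℕ) : Type :=
  MvPolynomial (Fin 2) (ZMod r) ⧸
    Ideal.span {(MvPolynomial.X 0 : MvPolynomial (Fin 2) (ZMod r)) ^ (r ^ k + 1),
      MvPolynomial.X 0 ^ r ^ k * MvPolynomial.X 1,
      MvPolynomial.X 1 ^ 2}

instance (r k : ℕ) : CommRing (Sring r k) :=
  Ideal.Quotient.commRing _

/-- The image of A in S. -/
def Avar (r k : ℕ) : Sring r k := Ideal.Quotient.mk _ (MvPolynomial.X 0)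

/-- The image of B in S. -/
def Bvar (r k : ℕ) : Sring r k := Ideal.Quotient.mk _ (MvPolynomial.X 1)

/-- The ideal M of ℍ[S] generated by A and B. -/
def Mideal (r k : ℕ) : Ideal ℍ[Sring r k] :=
  Ideal.span {algebraMap (Sring r k) ℍ[Sring r k] (Avar r k),
    algebraMap (Sring r k) ℍ[Sring r k] (Bvar r k)}

/-- The square M² of the ideal M, as an S-submodule of ℍ[S]. -/
def Msq (r k : ℕ) : Submodule (Sring r k) ℍ[Sring r k] :=
  ((Mideal r k).restrictScalars (Sring r k)) * ((Mideal r k).restrictScalars (Sring r k))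

lemma Bvar_sq (r k : ℕ) : Bvar r k * Bvar r k = 0 := by
  have h : (Ideal.Quotient.mk (Ideal.span
      {(MvPolynomial.X 0 : MvPolynomial (Fin 2) (ZMod r)) ^ (r ^ k + 1),
      MvPolynomial.X 0 ^ r ^ k * MvPolynomial.X 1,
      MvPolynomial.X 1 ^ 2})) (MvPolynomial.X 1 ^ 2) = 0 :=
    Ideal.Quotient.eq_zero_iff_mem.2 (Ideal.subset_span (by simp))
  rw [map_pow] at h
  rw [← pow_two]
  exact h

lemma Avar_nil (r k : ℕ) : Avar r k ^ (r ^ k + 1) = 0 := by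
  have h : (Ideal.Quotient.mk (Ideal.span
      {(MvPolynomial.X 0 : MvPolynomial (Fin 2) (ZMod r)) ^ (r ^ k + 1),
      MvPolynomial.X 0 ^ r ^ k * MvPolynomial.X 1,
      MvPolynomial.X 1 ^ 2})) (MvPolynomial.X 0 ^ (r ^ k + 1)) = 0 :=
    Ideal.Quotient.eq_zero_iff_mem.2 (Ideal.subset_span (by simp))
  rw [map_pow] at h
  exact h

lemma exists_inv_one_add_sq (r k : ℕ) :
    ∃ u : Sring r k, u * (1 + Avar r k * Avar r k) = 1 := by
  have hn : IsNilpotent (Avar r k * Avar r k) :=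
    (Commute.all _ _).isNilpotent_mul_right ⟨_, Avar_nil r k⟩
  obtain ⟨u, hu⟩ := hn.isUnit_one_add.exists_left_inv
  exact ⟨u, hu⟩

/-- The quaternion with given coordinates. -/
def qmk {R : Type*} [CommRing R] (a b c d : R) : ℍ[R] := ⟨a, b, c, d⟩

lemma qmk_congr {R : Type*} [CommRing R] {a b c d a' b' c' d' : R}
    (h1 : a = a') (h2 : b = b') (h3 : c = c') (h4 : d = d') : qmk a b c d = qmk a' b' c' d' := by
  rw [h1, h2, h3, h4]

lemma qmk_mul {R : Type*} [CommRing R] (a b c d a' b' c' d' : R) :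
    qmk a b c d * qmk a' b' c' d' = qmk (a * a' - b * b' - c * c' - d * d')
      (a * b' + b * a' + c * d' - d * c') (a * c' - b * d' + c * a' + d * b')
      (a * d' + b * c' - c * b' + d * a') := by
  refine Eq.trans (QuaternionAlgebra.mk_mul_mk (R := R) (c₁ := -1) (c₂ := 0) (c₃ := -1)
    a b c d a' b' c' d') (Eq.trans ?_ (rfl : qmk _ _ _ _ = _))
  refine Eq.trans (rfl : _ = qmk _ _ _ _) (qmk_congr ?_ ?_ ?_ ?_) <;> ring

lemma qmk_sub {R : Type*} [CommRing R] (a b c d a' b' c' d' : R) :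
    qmk a b c d - qmk a' b' c' d' = qmk (a - a') (b - b') (c - c') (d - d') := rfl

lemma qmk_one {R : Type*} [CommRing R] : (1 : ℍ[R]) = qmk 1 0 0 0 := rfl

lemma qmk_algebraMap {R : Type*} [CommRing R] (a : R) :
    algebraMap R ℍ[R] a = qmk a 0 0 0 := rfl

lemma AB_mem_Msq (r k : ℕ) (c : Sring r k) :
    qmk 0 0 0 (c * (Avar r k * Bvar r k)) ∈ Msq r k := by
  have hA : algebraMap (Sring r k) ℍ[Sring r k] (Avar r k) ∈
      (Mideal r k).restrictScalars (Sring r k) := Ideal.subset_span (Set.mem_insert _ _)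
  have hB : qmk 0 0 0 c * algebraMap (Sring r k) ℍ[Sring r k] (Bvar r k) ∈
      (Mideal r k).restrictScalars (Sring r k) :=
    (Mideal r k).mul_mem_left _ (Ideal.subset_span (Set.mem_insert_of_mem _ rfl))
  have h := Submodule.mul_mem_mul hA hB
  rw [qmk_algebraMap, qmk_algebraMap, qmk_mul, qmk_mul] at h
  have e := h
  refine (congrArg (· ∈ Msq r k) (qmk_congr ?_ ?_ ?_ ?_)).mp e <;> ring

/-- A quaternion and its inverse, as a unit, over a commutative ring. -/
def quatUnit {R : Type*} [CommRing R] (a b c d u : R)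
    (h : u * (a * a + b * b + c * c + d * d) = 1) : ℍ[R]ˣ where
  val := qmk a b c d
  inv := qmk (u * a) (-(u * b)) (-(u * c)) (-(u * d))
  val_inv := by
    rw [qmk_mul, qmk_one]
    apply qmk_congr <;> grind
  inv_val := by
    rw [qmk_mul, qmk_one]
    apply qmk_congr <;> grind

lemma exists_units {R : Type*} [CommRing R] (A B u : R) (hu : u * (1 + A * A) = 1)
    (hB : B * B = 0) : ∃ x1 y1 x2 y2 : ℍ[R]ˣ,
      (x1 : ℍ[R]) = qmk 1 A 0 0 ∧ (y1 : ℍ[R]) = qmk 1 0 B (-(A * B)) ∧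
      (x2 : ℍ[R]) = qmk 1 0 A 0 ∧ (y2 : ℍ[R]) = qmk 1 B 0 (A * B) ∧
      x1 * y1 * x1⁻¹ * y1⁻¹ * (x2 * y2 * x2⁻¹ * y2⁻¹) = 1 := by
  let x1 : ℍ[R]ˣ := quatUnit 1 A 0 0 u (by linear_combination hu)
  let x2 : ℍ[R]ˣ := quatUnit 1 0 A 0 u (by linear_combination hu)
  let y1 : ℍ[R]ˣ := quatUnit 1 0 B (-(A * B)) 1 (by linear_combination (1 + A * A) * hB)
  let y2 : ℍ[R]ˣ := quatUnit 1 B 0 (A * B) 1 (by linear_combination (1 + A * A) * hB)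
  let c1 : ℍ[R]ˣ := quatUnit 1 0 0 (2 * A * B) 1 (by linear_combination (4 * A * A) * hB)
  have h1 : x1 * y1 = c1 * (y1 * x1) := by
    apply Units.ext
    simp only [x1, y1, c1, quatUnit, Units.val_mul]
    simp only [qmk_mul]
    apply qmk_congr <;> grind
  have h2 : c1 * (x2 * y2) = y2 * x2 := by
    apply Units.ext
    simp only [x2, y2, c1, quatUnit, Units.val_mul]
    simp only [qmk_mul]
    apply qmk_congr <;> grind
  have e1 : x1 * y1 * x1⁻¹ * y1⁻¹ = c1 := by rw [h1]; group
  have e2 : x2 * y2 * x2⁻¹ * y2⁻¹ = c1⁻¹ := by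
    rw [show x2 * y2 = c1⁻¹ * (y2 * x2) by rw [← h2]; group]; group
  refine ⟨x1, y1, x2, y2, rfl, rfl, rfl, rfl, ?_⟩
  rw [e1, e2, mul_inv_cancel]

/-- Lemma 16: there is a homomorphism τ : π₁Σ₂ → ℍ[S]ˣ with
τ(x₁) ≡ 1 + Ai, τ(y₁) ≡ 1 + Bj, τ(x₂) ≡ 1 + Aj, τ(y₂) ≡ 1 + Bi mod M². -/
theorem hom_to_quaternion_units (r : ℕ) (hr : r.Prime) (hodd : Odd r) (k : ℕ) (hk : 1 ≤ k) :
    ∃ τ : SurfaceGroup 2 →* ℍ[Sring r k]ˣ,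
      ((τ (surfaceGen 2 (0, false)) : ℍ[Sring r k]) - ⟨1, Avar r k, 0, 0⟩ ∈ Msq r k) ∧
      ((τ (surfaceGen 2 (0, true)) : ℍ[Sring r k]) - ⟨1, 0, Bvar r k, 0⟩ ∈ Msq r k) ∧
      ((τ (surfaceGen 2 (1, false)) : ℍ[Sring r k]) - ⟨1, 0, Avar r k, 0⟩ ∈ Msq r k) ∧
      ((τ (surfaceGen 2 (1, true)) : ℍ[Sring r k]) - ⟨1, Bvar r k, 0, 0⟩ ∈ Msq r k) := by
  obtain ⟨u, hu⟩ := exists_inv_one_add_sq r k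
  obtain ⟨x1, y1, x2, y2, hx1, hy1, hx2, hy2, hrel⟩ :=
    exists_units (Avar r k) (Bvar r k) u hu (Bvar_sq r k)
  let f : Fin 2 × Bool → ℍ[Sring r k]ˣ := fun p =>
    if p.1 = 0 then (if p.2 then y1 else x1) else (if p.2 then y2 else x2)
  have f1 : f (0, false) = x1 := rfl
  have f2 : f (0, true) = y1 := rfl
  have f3 : f (1, false) = x2 := rfl
  have f4 : f (1, true) = y2 := rfl
  have hf : ∀ w ∈ ({surfaceRelator 2} : Set (FreeGroup (Fin 2 × Bool))),
      FreeGroup.lift f w = 1 := by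
    intro w hw
    rw [Set.mem_singleton_iff] at hw
    subst hw
    simp only [surfaceRelator, List.ofFn_succ, List.ofFn_zero, List.prod_cons, List.prod_nil,
      map_mul, map_inv, FreeGroup.lift_apply_of, mul_one, Fin.succ_zero_eq_one, f1, f2, f3, f4]
    exact hrel
  let τ : SurfaceGroup 2 →* ℍ[Sring r k]ˣ := PresentedGroup.toGroup hf
  have hτ : ∀ p, τ (surfaceGen 2 p) = f p := fun p => PresentedGroup.toGroup.of hf
  refine ⟨τ, ?_, ?_, ?_, ?_⟩
  · rw [hτ, f1, hx1]
    change qmk 1 (Avar r k) 0 0 - qmk 1 (Avar r k) 0 0 ∈ _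
    rw [sub_self]; exact zero_mem _
  · rw [hτ, f2, hy1]
    change qmk 1 0 (Bvar r k) (-(Avar r k * Bvar r k)) - qmk 1 0 (Bvar r k) 0 ∈ _
    rw [qmk_sub]
    refine (congrArg (· ∈ Msq r k) (qmk_congr ?_ ?_ ?_ ?_)).mp (AB_mem_Msq r k (-1)) <;> ring
  · rw [hτ, f3, hx2]
    change qmk 1 0 (Avar r k) 0 - qmk 1 0 (Avar r k) 0 ∈ _
    rw [sub_self]; exact zero_mem _
  · rw [hτ, f4, hy2]
    change qmk 1 (Bvar r k) 0 (Avar r k * Bvar r k) - qmk 1 (Bvar r k) 0 0 ∈ _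
    rw [qmk_sub]
    refine (congrArg (· ∈ Msq r k) (qmk_congr ?_ ?_ ?_ ?_)).mp (AB_mem_Msq r k 1) <;> ring
end
end

section
/- Let π be a group, let R be a normal subgroup of π of finite index N, and let θ : π → Q be a surjective group homomorphism onto a nontrivial finite group Q whose order is coprime to N. Then the abelianization of R is generated, as a group, by the images of the elements x^m with x ∈ π ∖ ker θ, m ∈ ℤ, and x^m ∈ R. -/
/-- Observation 18: if R is a normal subgroup of π of finite index N and θ : π → Q is a
surjective homomorphism onto a nontrivial finite group of order coprime to N, then the
abelianization of R is generated by the images of the powers x^m ∈ R of elements x ∉ ker θ. -/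
theorem coprime_nonkernel_generates (π : Type) [Group π]
    (R : Subgroup π) [R.Normal] (N : ℕ) (hN : R.index = N) (hfi : R.FiniteIndex)
    (Q : Type) [Group Q] [Finite Q] [Nontrivial Q]
    (θ : π →* Q) (hθ : Function.Surjective θ)
    (hcop : Nat.Coprime (Nat.card Q) N) :
    Subgroup.closure
      {a : Abelianization ↥R | ∃ (x : π) (m : ℤ) (h : x ^ m ∈ R),
        θ x ≠ 1 ∧ a = Abelianization.of (⟨x ^ m, h⟩ : ↥R)} = ⊤ := by
  have h1 : (R.map θ).index = 1 := by
    have ha : (R.map θ).index ∣ N := hN ▸ Subgroup.index_map_dvd R hθ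
    have hb : (R.map θ).index ∣ Nat.card Q := Subgroup.index_dvd_card _
    exact Nat.eq_one_of_dvd_coprimes hcop hb ha
  have htop : R.map θ = ⊤ := Subgroup.index_eq_one.mp h1
  obtain ⟨q, hq⟩ := exists_ne (1 : Q)
  have hqm : q ∈ R.map θ := htop ▸ Subgroup.mem_top q
  obtain ⟨s, hs, rfl⟩ := hqm
  set S : Set (Abelianization ↥R) := {a | ∃ (x : π) (m : ℤ) (h : x ^ m ∈ R),
        θ x ≠ 1 ∧ a = Abelianization.of (⟨x ^ m, h⟩ : ↥R)} with hS
  have key : ∀ r : ↥R, θ r ≠ 1 → Abelianization.of r ∈ Subgroup.closure S := by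
    intro r hr
    apply Subgroup.subset_closure
    refine ⟨r, 1, by simp, hr, ?_⟩
    congr 1
    ext
    simp
  rw [eq_top_iff]
  rintro a -
  obtain ⟨r, rfl⟩ := QuotientGroup.mk_surjective a
  change Abelianization.of r ∈ _
  by_cases hr : θ r = 1
  · have h2 := key (r * ⟨s, hs⟩) (by simpa [hr] using hq)
    have h3 := key ⟨s, hs⟩ hq
    rw [map_mul] at h2
    exact (Subgroup.mul_mem_cancel_right _ h3).mp h2
  · exact key r hr
end
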